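/- For every σ ∈ {132, 213, 231, 312} and every m ≥ 0, the number of parity-alternating permutations avoiding σ satisfies p_σ(2m) = (1/(2m+1))·binom(3m, m) and p_σ(2m+1) = (1/(2m+1))·binom(3m+1, m+1). -/

import Mathlib

open Finset

/-- A permutation `π` of `Fin n` contains the length-3 pattern `σ`
(given as a permutation of `Fin 3`, read as the word `σ 0, σ 1, σ 2`). -/
def Pattern3 {n : ℕ} (σ : Equiv.Perm (Fin 3)) (π : Equiv.Perm (Fin n)) : Prop :=
  ∃ f : Fin 3 → Fin n, StrictMono f ∧ ∀ a b : Fin 3, σ a < σ b ↔ π (f a) < π (f b)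

/-- The pattern 123. -/
def pat123 : Equiv.Perm (Fin 3) := 1
/-- The pattern 132. -/
def pat132 : Equiv.Perm (Fin 3) := Equiv.swap 1 2
/-- The pattern 213. -/
def pat213 : Equiv.Perm (Fin 3) := Equiv.swap 0 1
/-- The pattern 231. -/
def pat231 : Equiv.Perm (Fin 3) := finRotate 3
/-- The pattern 312. -/
def pat312 : Equiv.Perm (Fin 3) := (finRotate 3)⁻¹
/-- The pattern 321. -/
def pat321 : Equiv.Perm (Fin 3) := Equiv.swap 0 2

/-- Mod-k-alternating: `π(i) ≡ i (mod k)` (1-based; equivalently 0-based). -/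
def ModKAlt {n : ℕ} (k : ℕ) (π : Equiv.Perm (Fin n)) : Prop :=
  ∀ i : Fin n, (π i : ℕ) % k = (i : ℕ) % k

/-- `π(i) ≡ r + i − 1 (mod k)` for all `i ∈ [n]` (1-based). -/
def ModKAltR {n : ℕ} (k r : ℕ) (π : Equiv.Perm (Fin n)) : Prop :=
  ∀ i : Fin n, ((π i : ℕ) + 1) % k = (r + (i : ℕ)) % k

/-- `mp_σ(n,k)`: number of mod-k-alternating permutations of `[n]` avoiding `σ`. -/
noncomputable def mpPat (k : ℕ) (σ : Equiv.Perm (Fin 3)) (n : ℕ) : ℕ :=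
  Nat.card {π : Equiv.Perm (Fin n) // ModKAlt k π ∧ ¬ Pattern3 σ π}

/-- `mp_σ(n,k,r)`: number of permutations in `MP(n,k,r)` avoiding `σ`. -/
noncomputable def mpPatR (k r : ℕ) (σ : Equiv.Perm (Fin 3)) (n : ℕ) : ℕ :=
  Nat.card {π : Equiv.Perm (Fin n) // ModKAltR k r π ∧ ¬ Pattern3 σ π}

/-- `mp_{σ,τ}(n,k)`: number of mod-k-alternating permutations of `[n]` avoiding both `σ` and `τ`. -/
noncomputable def mpPat2 (k : ℕ) (σ τ : Equiv.Perm (Fin 3)) (n : ℕ) : ℕ :=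
  Nat.card {π : Equiv.Perm (Fin n) // ModKAlt k π ∧ ¬ Pattern3 σ π ∧ ¬ Pattern3 τ π}

/-- The revflip involution: `revflip(π)(i) = n + 1 − π(n + 1 − i)` (1-based). -/
def revflip {n : ℕ} (π : Equiv.Perm (Fin n)) : Equiv.Perm (Fin n) :=
  (Fin.revPerm.trans π).trans Fin.revPerm

/-- The `132`-avoiding permutations `f` of `{0, …, n - 1}` with `f i + i ≡ ε (mod 2)`,
as functions on `ℕ` extended by zero. -/
def AvoidSet (n ε : ℕ) : Set (ℕ → ℕ) :=
  {f | (∀ i < n, f i < n) ∧ (∀ i j, i < j → j < n → f i ≠ f j) ∧ (∀ i, n ≤ i → f i = 0) ∧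
    (∀ i < n, (f i + i) % 2 = ε) ∧ ∀ i j k, i < j → j < k → k < n → ¬ (f i < f k ∧ f k < f j)}

theorem pattern3_iff {n : ℕ} (σ : Equiv.Perm (Fin 3)) (π : Equiv.Perm (Fin n)) :
    Pattern3 σ π ↔ ∃ i j k : Fin n, i < j ∧ j < k ∧
      (σ 0 < σ 1 ↔ π i < π j) ∧ (σ 0 < σ 2 ↔ π i < π k) ∧ (σ 1 < σ 2 ↔ π j < π k) := by
  constructor
  · rintro ⟨f, hf, h⟩
    exact ⟨f 0, f 1, f 2, hf (by decide), hf (by decide), h _ _, h _ _, h _ _⟩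
  · rintro ⟨i, j, k, hij, hjk, h01, h02, h12⟩
    have flip : ∀ {a b : Fin 3} {x y : Fin n}, a ≠ b → x < y → (σ a < σ b ↔ π x < π y) →
        (σ b < σ a ↔ π y < π x) := by
      intro a b x y hab hxy h
      have h1 : σ a ≠ σ b := σ.injective.ne hab
      have h2 : π x ≠ π y := π.injective.ne hxy.ne
      rw [← not_le, ← not_le, h1.le_iff_lt, h2.le_iff_lt, h]
    refine ⟨![i, j, k], ?_, ?_⟩
    · intro a b hab
      fin_cases a <;> fin_cases b <;> simp_all
      exact hij.trans hjk
    · intro a b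
      fin_cases a <;> fin_cases b
      · simp
      · exact h01
      · exact h02
      · exact flip (by decide) hij h01
      · simp
      · exact h12
      · exact flip (by decide) (hij.trans hjk) h02
      · exact flip (by decide) hjk h12
      · simp

theorem pattern3_pat132_iff {n : ℕ} (π : Equiv.Perm (Fin n)) :
    Pattern3 pat132 π ↔ ∃ i j k : Fin n, i < j ∧ j < k ∧ π i < π k ∧ π k < π j := by
  rw [pattern3_iff]
  refine exists₃_congr fun i j k => and_congr_right fun hij => and_congr_right fun hjk => ?_
  have h1 := (π.injective.ne hij.ne)
  have h2 := (π.injective.ne hjk.ne)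
  have e : pat132 0 < pat132 1 ∧ pat132 0 < pat132 2 ∧ ¬ pat132 1 < pat132 2 := by decide
  simp only [e, true_iff, false_iff]
  omega

theorem pattern3_pat213_iff {n : ℕ} (π : Equiv.Perm (Fin n)) :
    Pattern3 pat213 π ↔ ∃ i j k : Fin n, i < j ∧ j < k ∧ π j < π i ∧ π i < π k := by
  rw [pattern3_iff]
  refine exists₃_congr fun i j k => and_congr_right fun hij => and_congr_right fun hjk => ?_
  have h1 := (π.injective.ne hij.ne)
  have h2 := (π.injective.ne hjk.ne)
  have e : ¬ pat213 0 < pat213 1 ∧ pat213 0 < pat213 2 ∧ pat213 1 < pat213 2 := by decide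
  simp only [e, true_iff, false_iff]
  omega

theorem pattern3_pat231_iff {n : ℕ} (π : Equiv.Perm (Fin n)) :
    Pattern3 pat231 π ↔ ∃ i j k : Fin n, i < j ∧ j < k ∧ π k < π i ∧ π i < π j := by
  rw [pattern3_iff]
  refine exists₃_congr fun i j k => and_congr_right fun hij => and_congr_right fun hjk => ?_
  have h1 := (π.injective.ne hij.ne)
  have h2 := (π.injective.ne hjk.ne)
  have h3 := (π.injective.ne (hij.trans hjk).ne)
  have e : pat231 0 < pat231 1 ∧ ¬ pat231 0 < pat231 2 ∧ ¬ pat231 1 < pat231 2 := by decide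
  simp only [e, true_iff, false_iff]
  omega

theorem pattern3_pat312_iff {n : ℕ} (π : Equiv.Perm (Fin n)) :
    Pattern3 pat312 π ↔ ∃ i j k : Fin n, i < j ∧ j < k ∧ π j < π k ∧ π k < π i := by
  rw [pattern3_iff]
  refine exists₃_congr fun i j k => and_congr_right fun hij => and_congr_right fun hjk => ?_
  have h1 := (π.injective.ne hij.ne)
  have h2 := (π.injective.ne hjk.ne)
  have h3 := (π.injective.ne (hij.trans hjk).ne)
  have e : ¬ pat312 0 < pat312 1 ∧ ¬ pat312 0 < pat312 2 ∧ pat312 1 < pat312 2 := by decide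
  simp only [e, true_iff, false_iff]
  omega

/-- The permutations of `Fin n` in parity class `ε` avoiding `132` are those of `AvoidSet n ε`. -/
noncomputable def permEquivAvoidSet (n ε : ℕ) :
    {π : Equiv.Perm (Fin n) // (∀ i, ((π i : ℕ) + i) % 2 = ε) ∧ ¬ Pattern3 pat132 π} ≃
      AvoidSet n ε := by
  refine Equiv.ofBijective
    (fun π => ⟨fun i => if h : i < n then (π.1 ⟨i, h⟩ : ℕ) else 0, ?_⟩) ⟨?_, ?_⟩
  · obtain ⟨π, hp, hav⟩ := π
    rw [pattern3_pat132_iff] at hav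
    refine ⟨?_, ?_, ?_, ?_, ?_⟩
    · intro i hi
      simp [hi]
    · intro i j hij hj
      simp [hj, hij.trans hj, Fin.val_inj, hij.ne]
    · intro i hi
      simp [hi]
    · intro i hi
      simpa [hi] using hp ⟨i, hi⟩
    · intro i j k hij hjk hk
      have hj := hjk.trans hk
      have hi := hij.trans hj
      simp only [hi, hj, hk, dite_true]
      exact fun h => hav ⟨⟨i, hi⟩, ⟨j, hj⟩, ⟨k, hk⟩, hij, hjk, h⟩
  · intro π π' h
    have h := congrArg Subtype.val h
    refine Subtype.ext (Equiv.ext fun i => Fin.ext ?_)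
    simpa using congrFun h i
  · rintro ⟨f, hlt, hinj, hz, hp, hav⟩
    have hb : Function.Bijective (fun i : Fin n => (⟨f i, hlt i i.2⟩ : Fin n)) := by
      rw [← Finite.injective_iff_bijective]
      intro i j h
      have h : f i = f j := congrArg Fin.val h
      rcases lt_trichotomy i j with hij | hij | hij
      · exact absurd h (hinj _ _ hij j.2)
      · exact hij
      · exact absurd h.symm (hinj _ _ hij i.2)
    refine ⟨⟨Equiv.ofBijective _ hb, fun i => hp i i.2, ?_⟩, ?_⟩
    · rw [pattern3_pat132_iff]
      rintro ⟨i, j, k, hij, hjk, h⟩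
      exact hav i j k hij hjk k.2 h
    · refine Subtype.ext (funext fun i => ?_)
      by_cases hi : i < n
      · simp [hi]
      · simp [hi, hz i (not_lt.mp hi)]

instance (n ε : ℕ) : Finite (AvoidSet n ε) := Finite.of_equiv _ (permEquivAvoidSet n ε)

theorem injOn_of_lt_ne {n : ℕ} {f : ℕ → ℕ} (hinj : ∀ i j, i < j → j < n → f i ≠ f j)
    {s : Finset ℕ} (hs : ∀ i ∈ s, i < n) : Set.InjOn f s := by
  intro i hi j hj h
  rcases lt_trichotomy i j with hij | hij | hij
  · exact absurd h (hinj _ _ hij (hs j hj))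
  · exact hij
  · exact absurd h.symm (hinj _ _ hij (hs i hi))

theorem exists_eq_of_mem_avoidSet {n ε : ℕ} {f : ℕ → ℕ} (hf : f ∈ AvoidSet (n + 1) ε) :
    ∃ k < n + 1, f k = n := by
  obtain ⟨hlt, hinj, -⟩ := hf
  have hmaps : ∀ i ∈ range (n + 1), f i ∈ range (n + 1) := by simpa using hlt
  have hi : Set.InjOn f (range (n + 1)) := injOn_of_lt_ne hinj (by simp)
  have := Finset.surjOn_of_injOn_of_card_le f hmaps hi le_rfl
  obtain ⟨k, hk, h⟩ := this (show n ∈ (range (n + 1) : Set ℕ) by simp)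
  exact ⟨k, by simpa using hk, h⟩

/-- In a `132`-avoiding permutation, the entries before the maximum exceed those after it. -/
theorem avoidSet_bounds {k l ε : ℕ} {f : ℕ → ℕ} (hf : f ∈ AvoidSet (k + l + 1) ε)
    (hk : f k = k + l) :
    (∀ i < k, l ≤ f i ∧ f i < k + l) ∧ ∀ j, k < j → j < k + l + 1 → f j < l := by
  obtain ⟨hlt, hinj, -, -, hav⟩ := hf
  have hne : ∀ i < k + l + 1, i ≠ k → f i < k + l := by
    intro i hi hik
    have h1 := hlt i hi
    have h2 : f i ≠ f k := by
      rcases lt_or_gt_of_ne hik with h | h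
      · exact hinj _ _ h (by omega)
      · exact (hinj _ _ h hi).symm
    omega
  have hcross : ∀ i j, i < k → k < j → j < k + l + 1 → f j < f i := by
    intro i j hi hj hjn
    have h1 := hav i k j hi hj hjn
    have h2 := hinj i j (hi.trans hj) hjn
    have h3 := hne j hjn hj.ne'
    omega
  refine ⟨fun i hi => ⟨?_, hne i (by omega) hi.ne⟩, fun j hj hjn => ?_⟩
  · have := Finset.card_le_card_of_injOn (s := Ioc k (k + l)) (t := range (f i)) f
      (by
        intro j hj
        simp only [coe_Ioc, Set.mem_Ioc] at hj
        simpa using hcross i j hi hj.1 (by omega))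
      (injOn_of_lt_ne hinj (by intro j hj; simp only [mem_Ioc] at hj; omega))
    simpa using this
  · have := Finset.card_le_card_of_injOn (s := range (k + 1)) (t := Ioc (f j) (k + l)) f
      (by
        intro i hi
        simp only [coe_range, Set.mem_Iio] at hi
        simp only [coe_Ioc, Set.mem_Ioc]
        have h3 := hne j hjn hj.ne'
        rcases (show i < k ∨ i = k by omega) with h | rfl
        · exact ⟨hcross i j h hj hjn, (hne i (by omega) h.ne).le⟩
        · omega)
      (injOn_of_lt_ne hinj (by intro i hi; simp only [mem_range] at hi; omega))
    simp only [card_range, Nat.card_Ioc] at this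
    have h3 := hne j hjn hj.ne'
    omega

/-- The permutation `L (k + l) R`, with the entries of `L` raised by `l`. -/
def glueMax (k l : ℕ) (L R : ℕ → ℕ) (i : ℕ) : ℕ :=
  if i < k then L i + l else if i = k then k + l else R (i - k - 1)

theorem glueMax_mem {k l : ℕ} {L R : ℕ → ℕ} (hL : L ∈ AvoidSet k 0)
    (hR : R ∈ AvoidSet l ((k + l + 1) % 2)) :
    glueMax k l L R ∈ AvoidSet (k + l + 1) (l % 2) := by
  obtain ⟨hL1, hL2, hL3, hL4, hL5⟩ := hL
  obtain ⟨hR1, hR2, hR3, hR4, hR5⟩ := hR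
  have hlow : ∀ i < k, glueMax k l L R i = L i + l := fun i hi => by simp [glueMax, hi]
  have hmid : glueMax k l L R k = k + l := by simp [glueMax]
  have hhigh : ∀ i, k < i → glueMax k l L R i = R (i - k - 1) := fun i hi => by
    simp [glueMax, hi.ne', hi.le]
  refine ⟨?_, ?_, ?_, ?_, ?_⟩
  · intro i hi
    rcases lt_trichotomy i k with h | rfl | h
    · rw [hlow i h]; have := hL1 i h; omega
    · omega
    · rw [hhigh i h]; have := hR1 (i - k - 1) (by omega); omega
  · intro i j hij hj
    rcases lt_trichotomy i k with h | rfl | h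
    · rw [hlow i h]
      have := hL1 i h
      rcases lt_trichotomy j k with h' | rfl | h'
      · rw [hlow j h']; have := hL2 i j hij h'; omega
      · omega
      · rw [hhigh j h']; have := hR1 (j - k - 1) (by omega); omega
    · rw [hhigh j hij]; have := hR1 (j - i - 1) (by omega); omega
    · rw [hhigh i h, hhigh j (by omega)]; exact hR2 _ _ (by omega) (by omega)
  · intro i hi
    rw [hhigh i (by omega)]; exact hR3 _ (by omega)
  · intro i hi
    rcases lt_trichotomy i k with h | rfl | h
    · rw [hlow i h]; have := hL4 i h; omega
    · omega
    · rw [hhigh i h]; have := hR4 (i - k - 1) (by omega); omega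
  · intro a b c hab hbc hc
    rcases lt_trichotomy c k with h | rfl | h
    · rw [hlow a (by omega), hlow b (by omega), hlow c h]
      have := hL5 a b c hab hbc h
      omega
    · rw [hlow b hbc]; have := hL1 b hbc; omega
    · rw [hhigh c h]
      have h1 := hR1 (c - k - 1) (by omega)
      rcases lt_trichotomy a k with h' | rfl | h'
      · rw [hlow a h']; omega
      · omega
      · rw [hhigh a h', hhigh b (by omega)]
        exact hR5 _ _ _ (by omega) (by omega) (by omega)

/-- Splitting a `132`-avoiding permutation at its maximum. -/
noncomputable def splitMaxEquiv (k l : ℕ) :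
    AvoidSet k 0 × AvoidSet l ((k + l + 1) % 2) ≃
      {f : AvoidSet (k + l + 1) (l % 2) // f.1 k = k + l} := by
  refine Equiv.ofBijective
    (fun p => ⟨⟨glueMax k l p.1.1 p.2.1, glueMax_mem p.1.2 p.2.2⟩, by simp [glueMax]⟩) ⟨?_, ?_⟩
  · rintro ⟨⟨L, hL⟩, ⟨R, hR⟩⟩ ⟨⟨L', hL'⟩, ⟨R', hR'⟩⟩ h
    have h : ∀ i, glueMax k l L R i = glueMax k l L' R' i :=
      congrFun (congrArg (fun f => f.1.1) h)
    have h1 : L = L' := by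
      funext i
      by_cases hi : i < k
      · simpa [glueMax, hi] using h i
      · rw [hL.2.2.1 i (by omega), hL'.2.2.1 i (by omega)]
    have h2 : R = R' := by
      funext i
      have e : k + 1 + i - k - 1 = i := by omega
      have h' : ¬ (k + 1 + i < k) ∧ ¬ (k + 1 + i = k) := by omega
      simpa only [glueMax, h'.1, h'.2, if_false, e] using h (k + 1 + i)
    subst h1 h2
    rfl
  · rintro ⟨⟨f, hf⟩, hk⟩
    obtain ⟨hlo, hhi⟩ := avoidSet_bounds hf hk
    obtain ⟨h1, h2, h3, h4, h5⟩ := hf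
    refine ⟨⟨⟨fun i => if i < k then f i - l else 0, ?_⟩, ⟨fun i => f (k + 1 + i), ?_⟩⟩, ?_⟩
    · refine ⟨?_, ?_, ?_, ?_, ?_⟩
      · intro i hi
        have := hlo i hi
        simp only [hi, if_true]; omega
      · intro i j hij hj
        have hi := hij.trans hj
        have a1 := hlo i hi
        have a2 := hlo j hj
        have a3 := h2 i j hij (by omega)
        simp only [hi, hj, if_true]; omega
      · intro i hi
        simp [hi]
      · intro i hi
        have a1 := hlo i hi
        have a2 := h4 i (by omega)
        simp only [hi, if_true]; omega
      · intro a b c hab hbc hc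
        have hb := hbc.trans hc
        have ha := hab.trans hb
        have a1 := hlo a ha
        have a2 := hlo b hb
        have a3 := hlo c hc
        have a4 := h5 a b c hab hbc (by omega)
        simp only [ha, hb, hc, if_true]; omega
    · refine ⟨?_, ?_, ?_, ?_, ?_⟩
      · exact fun i hi => hhi _ (by omega) (by omega)
      · exact fun i j hij hj => h2 _ _ (by omega) (by omega)
      · exact fun i hi => h3 _ (by omega)
      · intro i hi
        have a1 := h4 (k + 1 + i) (by omega)
        show (f (k + 1 + i) + i) % 2 = _
        have a2 := h4 k (by omega)
        omega
      · exact fun a b c hab hbc hc => h5 _ _ _ (by omega) (by omega) (by omega)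
    · refine Subtype.ext (Subtype.ext (funext fun i => ?_))
      simp only [glueMax]
      rcases lt_trichotomy i k with h | rfl | h
      · have := hlo i h
        simp only [h, if_true]; omega
      · simpa using hk.symm
      · have e : k + 1 + (i - k - 1) = i := by omega
        simp only [e, h.ne', if_false, not_lt.mpr h.le]

theorem card_avoidSet_zero (ε : ℕ) : Nat.card (AvoidSet 0 ε) = 1 := by
  have : AvoidSet 0 ε = {fun _ => 0} := by
    ext f
    simp [AvoidSet, funext_iff]
  rw [this, Nat.card_unique]

theorem card_avoidSet_succ (n ε : ℕ) :
    Nat.card (AvoidSet (n + 1) ε) = ∑ p ∈ antidiagonal n,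
      if p.2 % 2 = ε then Nat.card (AvoidSet p.1 0) * Nat.card (AvoidSet p.2 ((n + 1) % 2))
      else 0 := by
  have e : (Σ k : Fin (n + 1), {f : AvoidSet (n + 1) ε // f.1 k = n}) ≃ AvoidSet (n + 1) ε := by
    refine Equiv.ofBijective (fun x => x.2.1) ⟨?_, ?_⟩
    · rintro ⟨k, f, hk⟩ ⟨k', f', hk'⟩ h
      obtain rfl : f = f' := h
      have hinj := f.2.2.1
      obtain rfl : k = k' := by
        rcases lt_trichotomy k k' with h | h | h
        · exact absurd (hk.trans hk'.symm) (hinj _ _ h k'.2)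
        · exact h
        · exact absurd (hk'.trans hk.symm) (hinj _ _ h k.2)
      rfl
    · intro f
      obtain ⟨k, hk, h⟩ := exists_eq_of_mem_avoidSet f.2
      exact ⟨⟨⟨k, hk⟩, f, h⟩, rfl⟩
  rw [← Nat.card_congr e, Nat.card_sigma,
    Finset.sum_fin_eq_sum_range,
    Finset.Nat.sum_antidiagonal_eq_sum_range_succ_mk]
  refine Finset.sum_congr rfl fun k hk => ?_
  have hk : k < n + 1 := by simpa using hk
  obtain ⟨l, rfl⟩ : ∃ l, n = k + l := ⟨n - k, by omega⟩
  have hl : k + l - k = l := by omega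
  simp only [hk, dite_true, hl]
  split_ifs with h
  · subst h
    rw [← Nat.card_congr (splitMaxEquiv k l), Nat.card_prod]
  · have : IsEmpty {f : AvoidSet (k + l + 1) ε // f.1 k = k + l} := by
      refine ⟨fun f => h ?_⟩
      have := f.1.2.2.2.2.1 k (by omega)
      rw [f.2] at this
      omega
    exact Nat.card_of_isEmpty

theorem sum_antidiagonal_even_even (m : ℕ) (g : ℕ → ℕ → ℕ) :
    (∑ p ∈ antidiagonal (2 * m), if p.2 % 2 = 0 then g p.1 p.2 else 0) =
      ∑ p ∈ antidiagonal m, g (2 * p.1) (2 * p.2) := by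
  rw [← Finset.sum_filter]
  refine Finset.sum_nbij' (fun p => (p.1 / 2, p.2 / 2)) (fun p => (2 * p.1, 2 * p.2)) ?_ ?_ ?_ ?_ ?_
  · rintro ⟨a, b⟩ h; simp only [mem_filter, HasAntidiagonal.mem_antidiagonal] at h ⊢; omega
  · rintro ⟨a, b⟩ h; simp only [mem_filter, HasAntidiagonal.mem_antidiagonal] at h ⊢; omega
  · rintro ⟨a, b⟩ h; simp only [mem_filter, HasAntidiagonal.mem_antidiagonal, Prod.mk.injEq] at h ⊢; omega
  · rintro ⟨a, b⟩ h; simp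
  · rintro ⟨a, b⟩ h
    simp only [mem_filter, HasAntidiagonal.mem_antidiagonal] at h
    rw [show 2 * (a / 2) = a by omega, show 2 * (b / 2) = b by omega]

theorem sum_antidiagonal_odd_even (m : ℕ) (g : ℕ → ℕ → ℕ) :
    (∑ p ∈ antidiagonal (2 * m + 1), if p.2 % 2 = 0 then g p.1 p.2 else 0) =
      ∑ p ∈ antidiagonal m, g (2 * p.1 + 1) (2 * p.2) := by
  rw [← Finset.sum_filter]
  refine Finset.sum_nbij' (fun p => (p.1 / 2, p.2 / 2)) (fun p => (2 * p.1 + 1, 2 * p.2))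
    ?_ ?_ ?_ ?_ ?_
  · rintro ⟨a, b⟩ h; simp only [mem_filter, HasAntidiagonal.mem_antidiagonal] at h ⊢; omega
  · rintro ⟨a, b⟩ h; simp only [mem_filter, HasAntidiagonal.mem_antidiagonal] at h ⊢; omega
  · rintro ⟨a, b⟩ h; simp only [mem_filter, HasAntidiagonal.mem_antidiagonal, Prod.mk.injEq] at h ⊢; omega
  · rintro ⟨a, b⟩ h; simp only [Prod.mk.injEq]; omega
  · rintro ⟨a, b⟩ h
    simp only [mem_filter, HasAntidiagonal.mem_antidiagonal] at h
    rw [show 2 * (a / 2) + 1 = a by omega, show 2 * (b / 2) = b by omega]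

theorem sum_antidiagonal_even_odd (m : ℕ) (g : ℕ → ℕ → ℕ) :
    (∑ p ∈ antidiagonal (2 * m + 1), if p.2 % 2 = 1 then g p.1 p.2 else 0) =
      ∑ p ∈ antidiagonal m, g (2 * p.1) (2 * p.2 + 1) := by
  rw [← Finset.Nat.sum_antidiagonal_swap (n := m),
    ← Finset.Nat.sum_antidiagonal_swap (n := 2 * m + 1)]
  refine Eq.trans ?_ (sum_antidiagonal_odd_even m fun a b => g b a)
  refine Finset.sum_congr rfl fun p hp => ?_
  have : p.1 % 2 = 1 ↔ p.2 % 2 = 0 := by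
    rw [HasAntidiagonal.mem_antidiagonal] at hp; omega
  simp [this]

theorem card_avoidSet_even_succ (m : ℕ) :
    Nat.card (AvoidSet (2 * (m + 1)) 0) = ∑ p ∈ antidiagonal m,
      Nat.card (AvoidSet (2 * p.1 + 1) 0) * Nat.card (AvoidSet (2 * p.2) 0) := by
  rw [show 2 * (m + 1) = 2 * m + 1 + 1 by ring, card_avoidSet_succ,
    show (2 * m + 1 + 1) % 2 = 0 by omega]
  exact sum_antidiagonal_odd_even m fun a b => Nat.card (AvoidSet a 0) * Nat.card (AvoidSet b 0)

theorem card_avoidSet_even_one (m : ℕ) :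
    Nat.card (AvoidSet (2 * m) 1) = Nat.card (AvoidSet (2 * m) 0) := by
  cases m with
  | zero => rw [mul_zero, card_avoidSet_zero, card_avoidSet_zero]
  | succ m =>
    rw [card_avoidSet_even_succ, show 2 * (m + 1) = 2 * m + 1 + 1 by ring, card_avoidSet_succ,
      show (2 * m + 1 + 1) % 2 = 0 by omega, ← Finset.Nat.sum_antidiagonal_swap (n := m)]
    refine (sum_antidiagonal_even_odd m
      fun a b => Nat.card (AvoidSet a 0) * Nat.card (AvoidSet b 0)).trans ?_
    exact Finset.sum_congr rfl fun p _ => mul_comm _ _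

theorem card_avoidSet_odd (m : ℕ) :
    Nat.card (AvoidSet (2 * m + 1) 0) = ∑ p ∈ antidiagonal m,
      Nat.card (AvoidSet (2 * p.1) 0) * Nat.card (AvoidSet (2 * p.2) 0) := by
  rw [card_avoidSet_succ, show (2 * m + 1) % 2 = 1 by omega]
  refine (sum_antidiagonal_even_even m
    fun a b => Nat.card (AvoidSet a 0) * Nat.card (AvoidSet b 1)).trans ?_
  simp only [card_avoidSet_even_one]

/-- The coefficients of the powers of a solution of `F = 1 + X F ^ 3` are Fuss–Catalan numbers. -/
theorem coeff_pow_of_eq_one_add_X_mul_pow_three {F : PowerSeries ℚ}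
    (hF : F = 1 + PowerSeries.X * F ^ 3) (n r : ℕ) :
    (3 * n + r + 1) * PowerSeries.coeff n (F ^ (r + 1)) =
      (r + 1) * ((3 * n + r + 1).choose n : ℚ) := by
  have hstep : ∀ r, F ^ (r + 1) = F ^ r + PowerSeries.X * F ^ (r + 3) := by
    intro r
    calc F ^ (r + 1) = F ^ r * F := pow_succ _ _
      _ = F ^ r * (1 + PowerSeries.X * F ^ 3) := by rw [← hF]
      _ = _ := by ring
  induction n generalizing r with
  | zero =>
    have h0 : PowerSeries.constantCoeff F = 1 := by rw [hF]; simp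
    simp [h0]
  | succ n ih =>
    have key : ∀ r : ℕ, PowerSeries.coeff (n + 1) (F ^ (r + 1)) =
        PowerSeries.coeff (n + 1) (F ^ r) + PowerSeries.coeff n (F ^ (r + 3)) := by
      intro r
      rw [hstep r, map_add, PowerSeries.coeff_succ_X_mul]
    have pascal : ∀ a b : ℕ, ((a + 1).choose (b + 1) : ℚ) * (b + 1) = (a + 1) * a.choose b := by
      intro a b
      exact_mod_cast (Nat.add_one_mul_choose_eq a b).symm
    have absorb : ∀ a b : ℕ, b ≤ a →
        (a.choose (b + 1) : ℚ) * (b + 1) = a.choose b * (a - b) := by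
      intro a b hab
      have := Nat.choose_succ_right_eq a b
      rw [← Nat.cast_sub hab]
      exact_mod_cast this
    induction r with
    | zero =>
      have h1 := ih 2
      have h2 := pascal (3 * n + 3) n
      rw [key 0, pow_zero, PowerSeries.coeff_one, if_neg n.succ_ne_zero, zero_add]
      have hn : (n : ℚ) + 1 ≠ 0 := by positivity
      push_cast at h1 h2 ⊢
      rw [show 3 * (n + 1) + 0 + 1 = 3 * n + 3 + 1 by ring]
      rw [show 3 * n + 2 + 1 = 3 * n + 3 by ring] at h1
      refine mul_right_cancel₀ hn ?_
      linear_combination (n + 4 / 3 : ℚ) * h1 - h2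
    | succ r ihr =>
      have h1 := ih (r + 3)
      rw [key (r + 1)]
      have h2 := pascal (3 * n + r + 4) n
      have h3 := absorb (3 * n + r + 4) n (by omega)
      have hn : (n : ℚ) + 1 ≠ 0 := by positivity
      have hM : (3 * n + r + 4 : ℚ) ≠ 0 := by positivity
      rw [show 3 * (n + 1) + r + 1 = 3 * n + r + 4 by ring] at ihr
      rw [show 3 * n + (r + 3) + 1 = 3 * n + r + 4 by ring] at h1
      rw [show 3 * (n + 1) + (r + 1) + 1 = 3 * n + r + 4 + 1 by ring,
        show r + 1 + 3 = r + 3 + 1 by ring]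
      push_cast at ihr h1 h2 h3 ⊢
      refine mul_right_cancel₀ hn (mul_right_cancel₀ hM ?_)
      linear_combination (3 * n + r + 5 : ℚ) * (n + 1) * (ihr + h1) +
        (3 * n + r + 5 : ℚ) * (r + 1) * h3 - (3 * n + r + 4 : ℚ) * (r + 2) * h2

theorem card_avoidSet_eq (m : ℕ) :
    (Nat.card (AvoidSet (2 * m) 0) : ℚ) = 1 / (2 * m + 1) * ((3 * m).choose m) ∧
    (Nat.card (AvoidSet (2 * m + 1) 0) : ℚ) = 1 / (2 * m + 1) * ((3 * m + 1).choose (m + 1)) := by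
  set F : PowerSeries ℚ := PowerSeries.mk fun m => (Nat.card (AvoidSet (2 * m) 0) : ℚ) with hFdef
  have hsq : ∀ m, PowerSeries.coeff m (F ^ 2) = (Nat.card (AvoidSet (2 * m + 1) 0) : ℚ) := by
    intro m
    rw [sq, PowerSeries.coeff_mul, card_avoidSet_odd]
    simp [hFdef]
  have hF : F = 1 + PowerSeries.X * F ^ 3 := by
    ext m
    cases m with
    | zero => simp [hFdef, card_avoidSet_zero, -Nat.card_coe_set_eq]
    | succ m =>
      rw [map_add, PowerSeries.coeff_succ_X_mul, pow_succ F 2, PowerSeries.coeff_mul]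
      simp only [hsq]
      simp [hFdef, card_avoidSet_even_succ, PowerSeries.coeff_one, -Nat.card_coe_set_eq]
  have h1 := coeff_pow_of_eq_one_add_X_mul_pow_three hF m 0
  have h2 := coeff_pow_of_eq_one_add_X_mul_pow_three hF m 1
  rw [hsq] at h2
  rw [zero_add, pow_one] at h1
  simp only [hFdef, PowerSeries.coeff_mk] at h1
  have hc1 : ((3 * m + 1).choose m : ℚ) * (2 * m + 1) = (3 * m + 1) * (3 * m).choose m := by
    have := Nat.choose_mul_succ_eq (3 * m) m
    rw [show 3 * m + 1 - m = 2 * m + 1 by omega] at this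
    rw [mul_comm (3 * m + 1 : ℚ)]
    exact_mod_cast this.symm
  have hc2 : ((3 * m + 2).choose m : ℚ) * (2 * m + 2) = (3 * m + 2) * (3 * m + 1).choose m := by
    have := Nat.choose_mul_succ_eq (3 * m + 1) m
    rw [show 3 * m + 1 + 1 - m = 2 * m + 2 by omega] at this
    rw [mul_comm (3 * m + 2 : ℚ)]
    exact_mod_cast this.symm
  have hc3 : ((3 * m + 1).choose (m + 1) : ℚ) * (m + 1) = (3 * m + 1).choose m * (2 * m + 1) := by
    have := Nat.choose_succ_right_eq (3 * m + 1) m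
    rw [show 3 * m + 1 - m = 2 * m + 1 by omega] at this
    exact_mod_cast this
  have p0 : (2 * m + 1 : ℚ) ≠ 0 := by positivity
  have p1 : (3 * m + 1 : ℚ) ≠ 0 := by positivity
  have p2 : (3 * m + 2 : ℚ) ≠ 0 := by positivity
  have p3 : (m + 1 : ℚ) ≠ 0 := by positivity
  rw [add_zero] at h1
  rw [show 3 * m + 1 + 1 = 3 * m + 2 by ring] at h2
  push_cast at h1 h2
  constructor <;> rw [one_div, eq_inv_mul_iff_mul_eq₀ p0]
  · refine mul_left_cancel₀ p1 ?_
    linear_combination (2 * m + 1 : ℚ) * h1 + hc1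
  · refine mul_left_cancel₀ p2 (mul_left_cancel₀ p3 ?_)
    linear_combination (m + 1 : ℚ) * (2 * m + 1) * h2 + (2 * m + 1 : ℚ) * hc2 -
      (3 * m + 2 : ℚ) * hc3

theorem forall_add_mod_two_iff {n : ℕ} (π : Equiv.Perm (Fin n)) :
    ModKAlt 2 π ↔ ∀ i, ((π i : ℕ) + i) % 2 = 0 :=
  forall_congr' fun i => by omega

theorem mpPat_pat132 (n : ℕ) : mpPat 2 pat132 n = Nat.card (AvoidSet n 0) := by
  rw [← Nat.card_congr (permEquivAvoidSet n 0)]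
  simp only [mpPat, forall_add_mod_two_iff]

theorem mpPat_pat213 (n : ℕ) : mpPat 2 pat213 n = Nat.card (AvoidSet n 0) := by
  rw [← mpPat_pat132, mpPat, mpPat]
  have hinv : Function.Involutive (revflip (n := n)) := fun π => by
    ext i; simp [revflip]
  refine Nat.card_congr (hinv.toPerm.subtypeEquiv fun π => and_congr ?_ (not_congr ?_))
  · rw [Function.Involutive.coe_toPerm, ModKAlt, ModKAlt, ← Fin.revPerm.forall_congr_right]
    refine forall_congr' fun i => ?_
    simp only [revflip, Equiv.trans_apply, Fin.revPerm_apply, Fin.val_rev]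
    have := (π i.rev).2
    omega
  · rw [Function.Involutive.coe_toPerm, pattern3_pat213_iff, pattern3_pat132_iff]
    constructor
    · rintro ⟨i, j, k, h⟩
      exact ⟨k.rev, j.rev, i.rev, by simpa [revflip] using by tauto⟩
    · rintro ⟨i, j, k, h⟩
      exact ⟨k.rev, j.rev, i.rev, by simp [revflip] at h; simp; tauto⟩

theorem mpPat_pat231 (n : ℕ) : mpPat 2 pat231 n = Nat.card (AvoidSet n ((n + 1) % 2)) := by
  rw [← Nat.card_congr (permEquivAvoidSet n _), mpPat]
  refine Nat.card_congr ((Equiv.mulRight Fin.revPerm).subtypeEquiv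
    fun π => and_congr ?_ (not_congr ?_))
  · rw [ModKAlt, ← Fin.revPerm.forall_congr_right]
    refine forall_congr' fun i => ?_
    simp only [Equiv.coe_mulRight, Equiv.Perm.mul_apply, Fin.revPerm_apply, Fin.val_rev]
    omega
  · rw [pattern3_pat231_iff, pattern3_pat132_iff]
    constructor
    · rintro ⟨i, j, k, h⟩
      exact ⟨k.rev, j.rev, i.rev, by simp; tauto⟩
    · rintro ⟨i, j, k, h⟩
      exact ⟨k.rev, j.rev, i.rev, by simp at h; simp; tauto⟩

theorem mpPat_pat312 (n : ℕ) : mpPat 2 pat312 n = Nat.card (AvoidSet n ((n + 1) % 2)) := by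
  rw [← Nat.card_congr (permEquivAvoidSet n _), mpPat]
  refine Nat.card_congr ((Equiv.mulLeft Fin.revPerm).subtypeEquiv
    fun π => and_congr ?_ (not_congr ?_))
  · refine forall_congr' fun i => ?_
    simp only [Equiv.coe_mulLeft, Equiv.Perm.mul_apply, Fin.revPerm_apply, Fin.val_rev]
    omega
  · rw [pattern3_pat312_iff, pattern3_pat132_iff]
    refine exists₃_congr fun i j k => ?_
    simp
    tauto

theorem pap_single_pattern_count (σ : Equiv.Perm (Fin 3))
    (hσ : σ = pat132 ∨ σ = pat213 ∨ σ = pat231 ∨ σ = pat312) (m : ℕ) :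
    (mpPat 2 σ (2 * m) : ℚ) = 1 / (2 * m + 1) * ((3 * m).choose m) ∧
    (mpPat 2 σ (2 * m + 1) : ℚ) = 1 / (2 * m + 1) * ((3 * m + 1).choose (m + 1)) := by
  have he : (2 * m + 1) % 2 = 1 := by omega
  have ho : (2 * m + 1 + 1) % 2 = 0 := by omega
  have h := card_avoidSet_eq m
  rcases hσ with rfl | rfl | rfl | rfl
  · simpa only [mpPat_pat132] using h
  · simpa only [mpPat_pat213] using h
  · simpa only [mpPat_pat231, he, ho, card_avoidSet_even_one] using h
  · simpa only [mpPat_pat312, he, ho, card_avoidSet_even_one] using h
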